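/- arXiv:1612.01352 — 7 statements merged into one kernel-verified Lean document; each statement's English description precedes it below -/
import Mathlib

section
/- Let n : ℕ, let a₀ : ℝ, and let b : Fin n → Bool be a binary sequence. Define A : Fin (n+1) → ℝ recursively by A 0 = a₀ and, for each l, A (l+1) = A l + 1 if b l = false and A (l+1) = 2 * A l if b l = true. Let d be the number of indices l with b l = true and f = n - d the number of indices with b l = false. Then 2^d * a₀ + f ≤ A n ≤ 2^d * (a₀ + f). -/
/-- The path weight bounds, with the complemental path weight given as the number of zeros
of the path. -/
theorem path_weight_bounds_card {n : ℕ} (b : Fin n → Bool) (A : Fin (n + 1) → ℝ)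
    (hA : ∀ l : Fin n,
      A l.succ = if b l then 2 * A l.castSucc else A l.castSucc + 1) :
    2 ^ (Finset.univ.filter fun l : Fin n => b l = true).card * A 0
        + ((Finset.univ.filter fun l : Fin n => ¬ b l = true).card : ℝ) ≤ A (Fin.last n) ∧
      A (Fin.last n) ≤ 2 ^ (Finset.univ.filter fun l : Fin n => b l = true).card
        * (A 0 + ((Finset.univ.filter fun l : Fin n => ¬ b l = true).card : ℝ)) := by
  induction n with
  | zero => simp
  | succ n ih =>
    have h := ih (fun l => b l.castSucc) (fun l => A l.castSucc) fun l => hA l.castSucc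
    have hlast := hA (Fin.last n)
    rw [Fin.succ_last] at hlast
    simp only [Finset.card_filter, Fin.sum_univ_castSucc, Fin.castSucc_zero] at h ⊢
    rw [hlast]
    generalize (∑ l : Fin n, if b l.castSucc = true then 1 else 0) = d at h ⊢
    generalize (∑ l : Fin n, if ¬ b l.castSucc = true then 1 else 0) = f at h ⊢
    obtain ⟨hlow, hupp⟩ := h
    have hf : (0 : ℝ) ≤ f := f.cast_nonneg
    have hd : (1 : ℝ) ≤ 2 ^ d := one_le_pow₀ one_le_two
    by_cases hb : b (Fin.last n) = true
    · simp only [hb, if_true, not_true_eq_false, if_false, add_zero, pow_succ]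
      constructor <;> linarith
    · simp only [hb, Bool.false_eq_true, if_false, not_false_eq_true, if_true, add_zero,
        Nat.cast_add, Nat.cast_one]
      constructor <;> linarith

/-- Theorem 1 of the paper: bounds on the logarithmic Bhattacharyya parameter
recursion along a path `b` on the code tree. -/
theorem path_weight_bounds (n : ℕ) (a₀ : ℝ) (b : Fin n → Bool)
    (A : Fin (n + 1) → ℝ) (hA0 : A 0 = a₀)
    (hA : ∀ l : Fin n,
      A l.succ = if b l then 2 * A l.castSucc else A l.castSucc + 1)
    (d f : ℕ)
    (hd : d = (Finset.univ.filter fun l : Fin n => b l = true).card)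
    (hf : f = n - d) :
    2 ^ d * a₀ + (f : ℝ) ≤ A (Fin.last n) ∧
      A (Fin.last n) ≤ 2 ^ d * (a₀ + (f : ℝ)) := by
  have hcard := Finset.card_filter_add_card_filter_not (s := Finset.univ)
    fun l : Fin n => b l = true
  rw [Finset.card_univ, Fintype.card_fin, ← hd] at hcard
  have h := path_weight_bounds_card b A hA
  rwa [hA0, ← hd, show (Finset.univ.filter fun l : Fin n => ¬ b l = true).card = f by omega] at h
end

section
/- Let n ≥ 2 and let Q be an integer with 1 ≤ Q < 2^(n−1). Define the QUP punctured set B = { i : 0 ≤ i < 2^n and bitrev_n(i) < Q }. Let L = ⌊log₂ Q⌋. Then for any two neighboring punctured positions, i.e., any i, j ∈ B with i < j and no element of B strictly between i and j, the distance D = j − i satisfies 2^(n−L−1) ≤ D ≤ 2^(n−L). -/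
/-- The `n`-bit reversal of an integer `0 ≤ i < 2^n`. -/
def bitrev (n i : ℕ) : ℕ :=
  ∑ l ∈ Finset.range n, if i.testBit l then 2 ^ (n - 1 - l) else 0

/-- A multiple of `2 ^ m` has an `(m + L)`-bit reversal below `2 ^ L`. -/
theorem bitrev_two_pow_mul_lt (m L q : ℕ) : bitrev (m + L) (2 ^ m * q) < 2 ^ L := by
  unfold bitrev
  rw [Finset.sum_range_add, Finset.sum_eq_zero, zero_add]
  · calc
      _ ≤ ∑ x ∈ Finset.range L, 2 ^ (L - 1 - x) := by
        refine Finset.sum_le_sum fun x _ => ?_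
        rw [show m + L - 1 - (m + x) = L - 1 - x by omega]
        split_ifs <;> simp
      _ = ∑ x ∈ Finset.range L, 2 ^ x := Finset.sum_range_reflect (fun x => 2 ^ x) L
      _ < 2 ^ L := Nat.geomSum_lt le_rfl fun x hx => Finset.mem_range.mp hx
  · intro l hl
    have hlm : ¬ m ≤ l := not_le.mpr (Finset.mem_range.mp hl)
    simp [Nat.testBit_two_pow_mul, hlm]

/-- If the `(m + L)`-bit reversal of `i` is below `2 ^ L`, then `2 ^ m` divides `i`. -/
theorem two_pow_dvd_of_bitrev_lt {m L i : ℕ} (h : bitrev (m + L) i < 2 ^ L) : 2 ^ m ∣ i := by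
  refine Nat.dvd_of_mod_eq_zero (Nat.eq_of_testBit_eq fun l => ?_)
  rw [Nat.testBit_mod_two_pow, Nat.zero_testBit]
  by_contra hl
  obtain ⟨hlm, hb⟩ : l < m ∧ i.testBit l = true := by simpa using hl
  have hterm : (if i.testBit l then 2 ^ (m + L - 1 - l) else 0) ≤ bitrev (m + L) i :=
    Finset.single_le_sum (f := fun l => if i.testBit l then 2 ^ (m + L - 1 - l) else 0)
      (fun _ _ => Nat.zero_le _) (Finset.mem_range.mpr (by omega))
  rw [if_pos hb] at hterm
  have hpow : 2 ^ L ≤ 2 ^ (m + L - 1 - l) := Nat.pow_le_pow_right two_pos (by omega)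
  omega

/-- Theorem 5 of the paper: the punctured positions of the QUP puncturing
table are quasi-uniform: the distance `D` between any two neighboring
punctured positions satisfies `2^(n-L-1) ≤ D ≤ 2^(n-L)` with `L = ⌊log₂ Q⌋`. -/
theorem qup_quasi_uniform (n Q : ℕ) (hn : 2 ≤ n) (hQ1 : 1 ≤ Q)
    (hQ2 : Q < 2 ^ (n - 1))
    (B : Finset ℕ)
    (hB : B = (Finset.range (2 ^ n)).filter fun i => bitrev n i < Q)
    (L : ℕ) (hL : L = Nat.log 2 Q)
    (i j : ℕ) (hi : i ∈ B) (hj : j ∈ B) (hij : i < j)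
    (hneighbor : ∀ k ∈ B, ¬(i < k ∧ k < j)) :
    2 ^ (n - L - 1) ≤ j - i ∧ j - i ≤ 2 ^ (n - L) := by
  have hQlow : 2 ^ L ≤ Q := hL ▸ Nat.pow_log_le_self 2 (by omega)
  have hQhigh : Q < 2 ^ (L + 1) := hL ▸ Nat.lt_pow_succ_log_self one_lt_two Q
  have hLn : L < n - 1 := (Nat.pow_lt_pow_iff_right one_lt_two).mp (hQlow.trans_lt hQ2)
  subst hB
  simp only [Finset.mem_filter, Finset.mem_range] at hi hj hneighbor
  constructor
  · have hdvd {x : ℕ} (hx : bitrev n x < Q) : 2 ^ (n - L - 1) ∣ x := by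
      apply two_pow_dvd_of_bitrev_lt (L := L + 1)
      rw [show n - L - 1 + (L + 1) = n by omega]
      exact hx.trans hQhigh
    exact Nat.le_of_dvd (by omega) (Nat.dvd_sub (hdvd hj.2) (hdvd hi.2))
  · by_contra! hfar
    have hlt : i < 2 ^ (n - L) * (i / 2 ^ (n - L) + 1) :=
      Nat.lt_mul_div_succ i (by positivity)
    have hle : 2 ^ (n - L) * (i / 2 ^ (n - L)) ≤ i := Nat.mul_div_le _ _
    have hrev := bitrev_two_pow_mul_lt (n - L) L (i / 2 ^ (n - L) + 1)
    rw [show n - L + L = n by omega] at hrev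
    have hkj : 2 ^ (n - L) * (i / 2 ^ (n - L) + 1) < j := by
      rw [mul_add, mul_one]
      omega
    exact hneighbor _ ⟨hkj.trans hj.1, hrev.trans_le hQlow⟩ ⟨hlt, hkj⟩
end

section
/- Let n ≥ 1 and let M be an integer with 0 < M < 2^n. For every function α : ℕ → ℕ such that α l = 0 for all l ≥ n and ∑_{l<n} α l * 2^l = M, one has ∑_{l<n} α l * l * 2^l ≤ ∑_{l<n, bit l of M is one} l * 2^l. In other words, among all such decompositions α, the objective ∑ α l * l * 2^(l−1) is maximized when α is the binary-digit sequence of M (each α l ∈ {0,1}). -/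
theorem sum_testBit_two_pow (n M : ℕ) (hM : M < 2 ^ n) :
    ∑ l ∈ Finset.range n, (if M.testBit l then 2 ^ l else 0) = M := by
  induction n generalizing M with
  | zero => simp at hM; simp [hM]
  | succ n ih =>
    have h := ih (M / 2) (by rw [pow_succ] at hM; omega)
    have hshift : ∑ l ∈ Finset.range n, (if M.testBit (l + 1) then 2 ^ (l + 1) else 0) =
        2 * ∑ l ∈ Finset.range n, (if (M / 2).testBit l then 2 ^ l else 0) := by
      rw [Finset.mul_sum]
      refine Finset.sum_congr rfl fun l _ => ?_
      rw [Nat.testBit_succ]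
      split_ifs <;> ring
    rw [Finset.sum_range_succ', hshift, h, Nat.testBit_zero]
    simp only [decide_eq_true_eq, pow_zero]
    split_ifs <;> omega

/-- The binary expansion of `M` maximizes `∑ α l * l * 2 ^ l` even among all `α` with
`∑ α l * 2 ^ l ≤ M`. -/
theorem sum_mul_two_pow_le_sum_testBit (n M : ℕ) (hM : M < 2 ^ n) (α : ℕ → ℕ)
    (hsum : ∑ l ∈ Finset.range n, α l * 2 ^ l ≤ M) :
    ∑ l ∈ Finset.range n, α l * l * 2 ^ l ≤
      ∑ l ∈ Finset.range n, (if M.testBit l then l * 2 ^ l else 0) := by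
  induction n generalizing M α with
  | zero => simp
  | succ n ih =>
    have hM' : M / 2 < 2 ^ n := by rw [pow_succ] at hM; omega
    have hα : ∑ l ∈ Finset.range n, α (l + 1) * 2 ^ l ≤ M / 2 := by
      have hshift : ∑ l ∈ Finset.range n, α (l + 1) * 2 ^ (l + 1) =
          2 * ∑ l ∈ Finset.range n, α (l + 1) * 2 ^ l := by
        rw [Finset.mul_sum]
        exact Finset.sum_congr rfl fun l _ => by ring
      rw [Finset.sum_range_succ', hshift] at hsum
      omega
    have h := ih (M / 2) hM' (fun l => α (l + 1)) hα
    have hbits := sum_testBit_two_pow n (M / 2) hM'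
    have hleft : ∑ l ∈ Finset.range n, α (l + 1) * (l + 1) * 2 ^ (l + 1) =
        2 * (∑ l ∈ Finset.range n, α (l + 1) * l * 2 ^ l +
          ∑ l ∈ Finset.range n, α (l + 1) * 2 ^ l) := by
      rw [← Finset.sum_add_distrib, Finset.mul_sum]
      exact Finset.sum_congr rfl fun l _ => by ring
    have hright : ∑ l ∈ Finset.range n,
          (if M.testBit (l + 1) then (l + 1) * 2 ^ (l + 1) else 0) =
        2 * (∑ l ∈ Finset.range n, (if (M / 2).testBit l then l * 2 ^ l else 0) +
          ∑ l ∈ Finset.range n, (if (M / 2).testBit l then 2 ^ l else 0)) := by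
      rw [← Finset.sum_add_distrib, Finset.mul_sum]
      refine Finset.sum_congr rfl fun l _ => ?_
      rw [Nat.testBit_succ]
      split_ifs <;> ring
    rw [Finset.sum_range_succ', Finset.sum_range_succ', hleft, hright, hbits]
    simp only [mul_zero, zero_mul, ite_self, add_zero]
    omega


/-- Core of Theorem 6 of the paper: among all decompositions
`∑_{l<n} α l * 2^l = M` of the code length `M`, the binary expansion of `M`
maximizes the objective `∑ α l * l * 2^l` (twice the unnormalized SD1). -/
theorem qup_maximizes_sd1 (n M : ℕ) (hn : 1 ≤ n) (hM0 : 0 < M)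
    (hM : M < 2 ^ n) (α : ℕ → ℕ) (hα0 : ∀ l, n ≤ l → α l = 0)
    (hsum : ∑ l ∈ Finset.range n, α l * 2 ^ l = M) :
    ∑ l ∈ Finset.range n, α l * l * 2 ^ l ≤
      ∑ l ∈ (Finset.range n).filter (fun l => M.testBit l), l * 2 ^ l := by
  rw [Finset.sum_filter]
  exact sum_mul_two_pow_le_sum_testBit n M hM α hsum.le
end

section
/- Let n ≥ 2 and let M be an integer with 2^(n−1) < M < 2^n. Then (n−2) * M ≤ ∑_{l<n, bit l of M is one} l * 2^l ≤ (n−1) * M. Equivalently, the quantity (1/(2M)) * ∑_{l : bit l of M is one} l * 2^l lies between (n−2)/2 and (n−1)/2. -/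
theorem sum_two_pow_filter_testBit (M n : ℕ) :
    ∑ l ∈ (Finset.range n).filter (fun l => M.testBit l), 2 ^ l = M % 2 ^ n := by
  induction n with
  | zero => simp [Nat.mod_one]
  | succ n ih =>
    rw [Finset.sum_filter] at ih ⊢
    rw [Finset.sum_range_succ, ih, Nat.mod_pow_succ, Nat.testBit_eq_decide_div_mod_eq]
    rcases Nat.mod_two_eq_zero_or_one (M / 2 ^ n) with h | h <;> simp [h]

theorem sum_range_sub_mul_two_pow (m : ℕ) :
    ∑ l ∈ Finset.range (m + 1), (m - l) * 2 ^ l + m + 2 = 2 ^ (m + 1) := by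
  induction m with
  | zero => simp
  | succ m ih =>
    rw [Finset.sum_range_succ']
    have h : ∑ l ∈ Finset.range (m + 1), (m + 1 - (l + 1)) * 2 ^ (l + 1) =
        2 * ∑ l ∈ Finset.range (m + 1), (m - l) * 2 ^ l := by
      rw [Finset.mul_sum]
      refine Finset.sum_congr rfl fun l _ => ?_
      rw [Nat.add_sub_add_right, pow_succ]
      ring
    rw [h, pow_succ 2 (m + 1), ← ih]
    simp only [Nat.sub_zero, pow_zero]
    ring

/-- Theorem 8 of the paper: for `2^(n-1) < M < 2^n`, the SD1 of the QUP
punctured code satisfies `(n-2)/2 ≤ SD1 ≤ (n-1)/2`, i.e.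
`(n-2)*M ≤ ∑_{l ∈ F} l * 2^l ≤ (n-1)*M` where `F` is the set of set bits
of `M`. -/
theorem qup_sd1_bounds (n M : ℕ) (hn : 2 ≤ n) (h1 : 2 ^ (n - 1) < M)
    (h2 : M < 2 ^ n) :
    (n - 2) * M ≤ ∑ l ∈ (Finset.range n).filter (fun l => M.testBit l), l * 2 ^ l ∧
      ∑ l ∈ (Finset.range n).filter (fun l => M.testBit l), l * 2 ^ l ≤ (n - 1) * M := by
  have hM := sum_two_pow_filter_testBit M n
  rw [Nat.mod_eq_of_lt h2] at hM
  constructor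
  · obtain ⟨m, rfl⟩ := Nat.exists_eq_add_of_le' hn
    have htop : M.testBit (m + 1) = true :=
      Nat.testBit_of_two_pow_le_and_two_pow_add_one_gt h1.le h2
    rw [Finset.range_add_one, Finset.filter_insert, if_pos htop,
      Finset.sum_insert (by simp)] at hM ⊢
    set T := (Finset.range (m + 1)).filter (fun l => M.testBit l) with hT
    have hsplit : m * ∑ l ∈ T, 2 ^ l = ∑ l ∈ T, l * 2 ^ l + ∑ l ∈ T, (m - l) * 2 ^ l := by
      rw [Finset.mul_sum, ← Finset.sum_add_distrib]
      refine Finset.sum_congr rfl fun l hl => ?_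
      have hlm : l < m + 1 := Finset.mem_range.mp (Finset.mem_filter.mp hl).1
      rw [← add_mul, Nat.add_sub_cancel' (Nat.le_of_lt_succ hlm)]
    have hle : ∑ l ∈ T, (m - l) * 2 ^ l ≤ ∑ l ∈ Finset.range (m + 1), (m - l) * 2 ^ l :=
      Finset.sum_le_sum_of_subset (Finset.filter_subset _ _)
    have hsum := sum_range_sub_mul_two_pow m
    rw [Nat.add_sub_cancel, ← hM, mul_add, hsplit, add_mul]
    omega
  · calc ∑ l ∈ (Finset.range n).filter (fun l => M.testBit l), l * 2 ^ l
        ≤ ∑ l ∈ (Finset.range n).filter (fun l => M.testBit l), (n - 1) * 2 ^ l := by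
          refine Finset.sum_le_sum fun l hl => Nat.mul_le_mul_right _ ?_
          have hln : l < n := Finset.mem_range.mp (Finset.mem_filter.mp hl).1
          omega
      _ = (n - 1) * M := by rw [← Finset.mul_sum, hM]
end

section
/- Let n : ℕ, work over ZMod 2, and let G_n be the n-fold Kronecker power of the kernel F = !![1,0;1,1], realized as the matrix indexed by tuples i, j : Fin n → Fin 2 with entries G_n i j = ∏_{l<n} F (i l) (j l). For a tuple i, write ⟨i⟩ = ∑_{l<n} (i l)·2^(n−1−l) for the corresponding integer in [0, 2^n). Let t : ℕ and let u, u' : (Fin n → Fin 2) → ZMod 2 be two source vectors such that u i = u' i for every i with ⟨i⟩ ≥ t. Then (vecMul u G_n) j = (vecMul u' G_n) j for every j with ⟨j⟩ ≥ t. In particular, if the last Q source bits (those with ⟨i⟩ ≥ 2^n − Q) are frozen to fixed values, then the last Q code bits (those with ⟨j⟩ ≥ 2^n − Q) of x̂ = u · F^{⊗n} take fixed values known to the decoder. -/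
/-- The polar kernel is lower triangular. -/
theorem polarKernel_apply_eq_zero {R : Type*} [Zero R] [One R] {a b : Fin 2} (hab : a < b) :
    (!![1, 0; 1, 1] : Matrix (Fin 2) (Fin 2) R) a b = 0 := by
  fin_cases a <;> fin_cases b <;> simp_all

/-- Section VI of the paper: the RQUP algorithm ensures each punctured code
bit is known by the decoder.  If two source vectors `u`, `u'` agree on all
source bits with numerical index `≥ t`, then the codewords `u · G_n` and
`u' · G_n` (with `G_n` the `n`-fold Kronecker power of the polar kernel
`F = !![1,0;1,1]` over GF(2)) agree on all code bits with numerical index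
`≥ t`. -/
theorem rqup_punctured_bits_known (n : ℕ)
    (F : Matrix (Fin 2) (Fin 2) (ZMod 2)) (hF : F = !![1, 0; 1, 1])
    (G : Matrix (Fin n → Fin 2) (Fin n → Fin 2) (ZMod 2))
    (hG : ∀ i j, G i j = ∏ l, F (i l) (j l))
    (num : (Fin n → Fin 2) → ℕ)
    (hnum : ∀ i, num i = ∑ l, (i l : ℕ) * 2 ^ (n - 1 - (l : ℕ)))
    (t : ℕ) (u u' : (Fin n → Fin 2) → ZMod 2)
    (h : ∀ i, t ≤ num i → u i = u' i) :
    ∀ j, t ≤ num j → Matrix.vecMul u G j = Matrix.vecMul u' G j := by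
  intro j hj
  simp only [Matrix.vecMul, dotProduct]
  refine Finset.sum_congr rfl fun i _ => ?_
  by_cases hle : j ≤ i
  · have hnum_le : num j ≤ num i := by
      rw [hnum, hnum]
      exact Finset.sum_le_sum fun l _ => Nat.mul_le_mul_right _ (hle l)
    rw [h i (hj.trans hnum_le)]
  · obtain ⟨l, hl⟩ : ∃ l, i l < j l := by simpa [Pi.le_def] using hle
    have hzero : G i j = 0 := by
      rw [hG, hF]
      exact Finset.prod_eq_zero (Finset.mem_univ l) (polarKernel_apply_eq_zero hl)
    simp [hzero]
end

section
/- Let Y be a finite type and let W : Bool → Y → ℝ satisfy W b y ≥ 0 for all b, y and ∑_{y} W b y = 1 for each b, with Bhattacharyya parameter Z(W) = ∑_{y} √(W false y * W true y). Consider two-channel polarization under the capacity-zero mode, where the punctured channel has output alphabet Bool and transition probabilities identically 1/2. (a) If the first code bit x₁ = u₁ ⊕ u₂ is punctured (table (0,1)), the polarized channels are V₁ u₁ (y₁,y₂) = ∑_{u₂ : Bool} (1/2)·(1/2)·W u₂ y₂ and V₂ u₂ (y₁,y₂,u₁) = (1/2)·(1/2)·W u₂ y₂, and one has ∑_{(y₁,y₂)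 ∈ Bool × Y} √(V₁ false (y₁,y₂) * V₁ true (y₁,y₂)) = 1 and ∑_{(y₁,y₂,u₁) ∈ Bool × Y × Bool} √(V₂ false (y₁,y₂,u₁) * V₂ true (y₁,y₂,u₁)) = Z(W). (b) If instead the second code bit x₂ = u₂ is punctured (table (1,0)), the polarized channels are V₁' u₁ (y₁,y₂) = ∑_{u₂ : Bool} (1/2)·W (u₁ ⊕ u₂) y₁·(1/2) and V₂' u₂ (y₁,y₂,u₁) = (1/2)·W (u₁ ⊕ u₂) y₁·(1/2), and again ∑ √(V₁' false * V₁' true) = 1 and ∑ √(V₂' false * V₂' true) = Z(W). Hence both puncturing tables produce the same polarization results: Z(W̃₂^(1)) = 1 and Z(W̃₂^(2)) = Z(W). -/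
/-- The Bhattacharyya term of two transition probabilities, each scaled by `1 / 4`. -/
theorem sqrt_quarter_mul_quarter (a b : ℝ) :
    Real.sqrt ((1 / 4 * a) * (1 / 4 * b)) = 1 / 4 * Real.sqrt (a * b) := by
  rw [mul_mul_mul_comm, Real.sqrt_mul (by norm_num), Real.sqrt_mul_self (by norm_num)]


/-- Lemma 2 of the paper: two-channel polarization under the capacity-zero
(C0) puncturing mode.  Whether the first code bit (table `(0,1)`) or the
second code bit (table `(1,0)`) is punctured, the polarized channels have
Bhattacharyya parameters `Z(W̃₂⁽¹⁾) = 1` and `Z(W̃₂⁽²⁾) = Z(W)`. -/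
theorem c0_two_channel_polarization {Y : Type*} [Fintype Y]
    (W : Bool → Y → ℝ) (hpos : ∀ b y, 0 ≤ W b y)
    (hsum : ∀ b, ∑ y, W b y = 1)
    (Z : ℝ) (hZ : Z = ∑ y, Real.sqrt (W false y * W true y))
    -- (a) first code bit `x₁ = u₁ ⊕ u₂` punctured, table (0,1)
    (V₁ : Bool → Bool × Y → ℝ)
    (hV₁ : ∀ u₁ y₁ y₂, V₁ u₁ (y₁, y₂)
      = ∑ u₂ : Bool, (1 / 2) * ((1 / 2) * W u₂ y₂))
    (V₂ : Bool → Bool × Y × Bool → ℝ)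
    (hV₂ : ∀ u₂ y₁ y₂ u₁, V₂ u₂ (y₁, y₂, u₁)
      = (1 / 2) * ((1 / 2) * W u₂ y₂))
    -- (b) second code bit `x₂ = u₂` punctured, table (1,0)
    (V₁' : Bool → Y × Bool → ℝ)
    (hV₁' : ∀ u₁ y₁ y₂, V₁' u₁ (y₁, y₂)
      = ∑ u₂ : Bool, (1 / 2) * W (Bool.xor u₁ u₂) y₁ * (1 / 2))
    (V₂' : Bool → Y × Bool × Bool → ℝ)
    (hV₂' : ∀ u₂ y₁ y₂ u₁, V₂' u₂ (y₁, y₂, u₁)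
      = (1 / 2) * W (Bool.xor u₁ u₂) y₁ * (1 / 2)) :
    (∑ p : Bool × Y, Real.sqrt (V₁ false p * V₁ true p)) = 1 ∧
      (∑ p : Bool × Y × Bool, Real.sqrt (V₂ false p * V₂ true p)) = Z ∧
      (∑ p : Y × Bool, Real.sqrt (V₁' false p * V₁' true p)) = 1 ∧
      (∑ p : Y × Bool × Bool, Real.sqrt (V₂' false p * V₂' true p)) = Z := by
  have sqrt_eq (y : Y) :
      Real.sqrt ((1 / 4 * (W false y + W true y)) * (1 / 4 * (W false y + W true y)))
        = 1 / 4 * (W false y + W true y) :=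
    Real.sqrt_mul_self (mul_nonneg (by norm_num) (add_nonneg (hpos _ _) (hpos _ _)))
  have hV₁_eq (u y₁ y₂) : V₁ u (y₁, y₂) = 1 / 4 * (W false y₂ + W true y₂) := by
    rw [hV₁, Fintype.sum_bool]
    ring
  have hV₂_eq (u₂ y₁ y₂ u₁) : V₂ u₂ (y₁, y₂, u₁) = 1 / 4 * W u₂ y₂ := by
    rw [hV₂]
    ring
  have hV₁'_eq (u y₁ y₂) : V₁' u (y₁, y₂) = 1 / 4 * (W false y₁ + W true y₁) := by
    rw [hV₁', Fintype.sum_bool]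
    cases u <;> simp only [Bool.xor_false, Bool.xor_true, Bool.not_false, Bool.not_true] <;> ring
  have hV₂'_eq (u₂ y₁ y₂ u₁) : V₂' u₂ (y₁, y₂, u₁) = 1 / 4 * W (Bool.xor u₁ u₂) y₁ := by
    rw [hV₂']
    ring
  subst hZ
  refine ⟨?_, ?_, ?_, ?_⟩
  · simp only [Fintype.sum_prod_type, Fintype.sum_bool, hV₁_eq, sqrt_eq, ← Finset.mul_sum,
      Finset.sum_add_distrib, hsum]
    norm_num
  · simp only [Fintype.sum_prod_type, Fintype.sum_bool, hV₂_eq, sqrt_quarter_mul_quarter,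
      Finset.sum_add_distrib, ← Finset.mul_sum]
    ring
  · simp only [Fintype.sum_prod_type, Fintype.sum_bool, hV₁'_eq, sqrt_eq, ← Finset.mul_sum,
      Finset.sum_add_distrib, hsum]
    norm_num
  · simp only [Fintype.sum_prod_type, Fintype.sum_bool, hV₂'_eq, sqrt_quarter_mul_quarter,
      Bool.xor_false, Bool.xor_true, Bool.not_false, Bool.not_true, mul_comm (W true _),
      Finset.sum_add_distrib, ← Finset.mul_sum]
    ring
end

section
/- Let Y be a finite type and let W : Bool → Y → ℝ satisfy W b y ≥ 0 for all b, y and ∑_{y} W b y = 1 for each b, with Bhattacharyya parameter Z(W) = ∑_{y} √(W false y * W true y). Consider two-channel polarization under the capacity-one mode with the second code bit x₂ = u₂ punctured (table (1,0)), where the punctured channel is the perfect channel over Bool with 𝕎 u y = 1 if y = u and 0 otherwise. The polarized channels are V₁ u₁ (y₁,y₂) = ∑_{u₂ : Bool} (1/2)·W (u₁ ⊕ u₂) y₁·(if y₂ = u₂ then 1 else 0) and V₂ u₂ (y₁,y₂,u₁) = (1/2)·W (u₁ ⊕ u₂) y₁·(if y₂ = u₂ then 1 else 0). Then ∑_{(y₁,y₂)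 ∈ Y × Bool} √(V₁ false (y₁,y₂) * V₁ true (y₁,y₂)) = Z(W) and ∑_{(y₁,y₂,u₁) ∈ Y × Bool × Bool} √(V₂ false (y₁,y₂,u₁) * V₂ true (y₁,y₂,u₁)) = 0. That is, Z(W̃₂^(1)) = Z(W) and Z(W̃₂^(2)) = 0. -/
/-- Lemma 3 of the paper: two-channel polarization under the capacity-one
(C1) puncturing mode, with the second code bit `x₂ = u₂` punctured
(table `(1,0)`) and transmitted over the perfect channel.  The polarized
channels have Bhattacharyya parameters `Z(W̃₂⁽¹⁾) = Z(W)` and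
`Z(W̃₂⁽²⁾) = 0`. -/
theorem c1_two_channel_polarization {Y : Type*} [Fintype Y]
    (W : Bool → Y → ℝ) (hpos : ∀ b y, 0 ≤ W b y)
    (hsum : ∀ b, ∑ y, W b y = 1)
    (Z : ℝ) (hZ : Z = ∑ y, Real.sqrt (W false y * W true y))
    (V₁ : Bool → Y × Bool → ℝ)
    (hV₁ : ∀ u₁ y₁ y₂, V₁ u₁ (y₁, y₂)
      = ∑ u₂ : Bool, (1 / 2) * W (Bool.xor u₁ u₂) y₁
          * (if y₂ = u₂ then 1 else 0))
    (V₂ : Bool → Y × Bool × Bool → ℝ)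
    (hV₂ : ∀ u₂ y₁ y₂ u₁, V₂ u₂ (y₁, y₂, u₁)
      = (1 / 2) * W (Bool.xor u₁ u₂) y₁ * (if y₂ = u₂ then 1 else 0)) :
    (∑ p : Y × Bool, Real.sqrt (V₁ false p * V₁ true p)) = Z ∧
      (∑ p : Y × Bool × Bool, Real.sqrt (V₂ false p * V₂ true p)) = 0 := by
  have sqrt_quarter (a b : ℝ) :
      Real.sqrt ((1 / 2 * a) * (1 / 2 * b)) = 1 / 2 * Real.sqrt (a * b) := by
    rw [show (1 / 2 * a) * (1 / 2 * b) = (1 / 2) ^ 2 * (a * b) by ring,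
      Real.sqrt_mul (by positivity), Real.sqrt_sq (by norm_num)]
  have hV (u₁ : Bool) (y₁ : Y) (y₂ : Bool) :
      V₁ u₁ (y₁, y₂) = 1 / 2 * W (Bool.xor u₁ y₂) y₁ := by
    rw [hV₁]
    simp
  constructor
  · rw [hZ, Fintype.sum_prod_type]
    refine Finset.sum_congr rfl fun y _ => ?_
    simp only [Fintype.sum_bool, hV, sqrt_quarter, Bool.xor_true, Bool.xor_false,
      Bool.not_true, Bool.not_false]
    rw [mul_comm (W true y)]
    ring
  · refine Finset.sum_eq_zero fun ⟨y₁, y₂, u₁⟩ _ => ?_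
    cases y₂ <;> simp [hV₂]
end
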